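/- Let i ∈ {1,2} and let q be an action minimizer of A over P(Q_S, Q_{E_i}) such that q is continuously differentiable on [0,1], is a classical solution of the Newtonian equations on (0,1), and has no collision at t = 0. Define the extended path q̄ on [−1,1] by q̄(t) = q(t) for t ∈ [0,1], and for t ∈ [−1,0]: q̄₁(t) = (q_{1x}(−t), −q_{1y}(−t)), q̄₂(t) = (q_{2x}(−t), −q_{2y}(−t)), q̄₃(t) = (q_{4x}(−t), −q_{4y}(−t)), q̄₄(t) = (q_{3x}(−t), −q_{3y}(−t)). Then q̄ is a classical (twice continuously differentiable, collision-free) solution of the Newtonian equations on the open interval (−1,1). -/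

import Mathlib

open Real MeasureTheory Set
open scoped ENNReal

noncomputable section

/-- Euclidean norm on `ℝ × ℝ` (row vectors in the plane). -/
def enorm2 (v : ℝ × ℝ) : ℝ := Real.sqrt (v.1 ^ 2 + v.2 ^ 2)

/-- Row vector multiplied on the right by the rotation matrix `R θ`
with rows `(cos θ, sin θ)` and `(-sin θ, cos θ)`. -/
def rotV (θ : ℝ) (v : ℝ × ℝ) : ℝ × ℝ :=
  (v.1 * Real.cos θ - v.2 * Real.sin θ, v.1 * Real.sin θ + v.2 * Real.cos θ)

/-- `H¹([0,1],(ℝ²)⁴)`: absolutely continuous paths `[0,1] → (ℝ²)⁴` with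
square-integrable derivative, recorded via an integrable (a.e.-)derivative `v`
together with the integral representation of `q`. -/
structure H1Path4 where
  q : ℝ → Fin 4 → ℝ × ℝ
  v : ℝ → Fin 4 → ℝ × ℝ
  hvInt : ∀ i : Fin 4, IntegrableOn (fun t => v t i) (Icc (0:ℝ) 1)
  hrep : ∀ i : Fin 4, ∀ t ∈ Icc (0:ℝ) 1, q t i = q 0 i + ∫ s in (0:ℝ)..t, v s i
  hL2 : ∀ i : Fin 4, IntegrableOn (fun t => enorm2 (v t i) ^ 2) (Icc (0:ℝ) 1)

/-- Center of mass at the origin throughout `[0,1]` (the path lies in `χ`). -/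
def H1Path4.inChi (p : H1Path4) : Prop := ∀ t ∈ Icc (0:ℝ) 1, ∑ i, p.q t i = 0

/-- The Lagrangian action functional `A`, with value `+∞` allowed. -/
def action (p : H1Path4) : ℝ≥0∞ :=
  ∫⁻ t in Icc (0:ℝ) 1,
    (ENNReal.ofReal ((1/2) * ∑ i, enorm2 (p.v t i) ^ 2)
      + ∑ i : Fin 4, ∑ j ∈ Finset.univ.filter (fun j => i < j),
          (ENNReal.ofReal (enorm2 (p.q t i - p.q t j)))⁻¹)

/-- The starting boundary configuration set `Q_S` (double isosceles with order
constraints). -/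
def QSset : Set (Fin 4 → ℝ × ℝ) :=
  { c | ∃ a₁ b₁ c₁ : ℝ, 0 ≤ b₁ ∧ 0 ≤ c₁ ∧
      c = ![(-a₁ - c₁, 0), (-a₁, 0), ((2*a₁ + c₁)/2, b₁), ((2*a₁ + c₁)/2, -b₁)] }

/-- The ending boundary configuration set `Q_{E₁}`. -/
def QE1set (θ : ℝ) : Set (Fin 4 → ℝ × ℝ) :=
  { c | ∃ a₂ b₂ c₂ : ℝ, 0 ≤ b₂ ∧ 0 ≤ c₂ ∧
      c = fun i => rotV θ (![(-b₂, -a₂), (-c₂, a₂), (c₂, a₂), (b₂, -a₂)] i) }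

/-- The ending boundary configuration set `Q_{E₂}`. -/
def QE2set (θ : ℝ) : Set (Fin 4 → ℝ × ℝ) :=
  { c | ∃ a₂ b₂ c₂ : ℝ, 0 ≤ b₂ ∧ 0 ≤ c₂ ∧
      c = fun i => rotV θ (![(-a₂, -b₂), (-a₂, b₂), (a₂, c₂), (a₂, -c₂)] i) }

/-- Membership in the admissible class `P(Q_S, E)`. -/
def inAdm (E : Set (Fin 4 → ℝ × ℝ)) (p : H1Path4) : Prop :=
  p.inChi ∧ p.q 0 ∈ QSset ∧ p.q 1 ∈ E

/-- `p` is an action minimizer over `P(Q_S, E)`. -/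
def isMin (E : Set (Fin 4 → ℝ × ℝ)) (p : H1Path4) : Prop :=
  inAdm E p ∧ ∀ p' : H1Path4, inAdm E p' → action p ≤ action p'

/-- The Newtonian equations of the equal-mass four-body problem, on a set `s`
of times. -/
def newton (Q : ℝ → Fin 4 → ℝ × ℝ) (s : Set ℝ) : Prop :=
  ∀ i : Fin 4, ∀ t ∈ s,
    deriv (deriv (fun u => Q u i)) t =
      ∑ j ∈ Finset.univ.erase i, (1 / enorm2 (Q t j - Q t i) ^ 3) • (Q t j - Q t i)

/-- Euclidean inner product on `ℝ × ℝ`. -/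
def dot2 (v w : ℝ × ℝ) : ℝ := v.1 * w.1 + v.2 * w.2

/-- Configurations without collisions. -/
def collisionFree : Set (Fin 4 → ℝ × ℝ) := {c | ∀ i j : Fin 4, i ≠ j → c i ≠ c j}

/-- Right-hand side of the Newtonian equations. -/
def force (c : Fin 4 → ℝ × ℝ) (i : Fin 4) : ℝ × ℝ :=
  ∑ j ∈ Finset.univ.erase i, (1 / enorm2 (c j - c i) ^ 3) • (c j - c i)

/-- Negative of the Newtonian potential energy. -/
def potential (c : Fin 4 → ℝ × ℝ) : ℝ :=
  ∑ i : Fin 4, ∑ j ∈ Finset.univ.filter (fun j => i < j), (enorm2 (c i - c j))⁻¹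

/-- Kinetic energy. -/
def kinetic (v : Fin 4 → ℝ × ℝ) : ℝ := (1 / 2) * ∑ i, enorm2 (v i) ^ 2

lemma enorm2_nonneg (v : ℝ × ℝ) : 0 ≤ enorm2 v := Real.sqrt_nonneg _

lemma enorm2_sq (v : ℝ × ℝ) : enorm2 v ^ 2 = v.1 ^ 2 + v.2 ^ 2 :=
  Real.sq_sqrt (by positivity)

lemma enorm2_pos {v : ℝ × ℝ} (hv : v ≠ 0) : 0 < enorm2 v := by
  refine Real.sqrt_pos.2 ?_
  by_contra! h
  apply hv
  ext <;> simp <;> nlinarith [sq_nonneg v.1, sq_nonneg v.2]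

lemma enorm2_sub_comm (v w : ℝ × ℝ) : enorm2 (v - w) = enorm2 (w - v) := by
  simp only [enorm2, Prod.fst_sub, Prod.snd_sub]
  congr 1
  ring

@[fun_prop]
lemma continuous_enorm2 : Continuous enorm2 := by
  unfold enorm2
  fun_prop

lemma enorm2_le_two_mul_norm (v : ℝ × ℝ) : enorm2 v ≤ 2 * ‖v‖ := by
  have h₁ : |v.1| ≤ ‖v‖ := norm_fst_le v
  have h₂ : |v.2| ≤ ‖v‖ := norm_snd_le v
  refine Real.sqrt_le_iff.2 ⟨by positivity, ?_⟩
  nlinarith [sq_abs v.1, sq_abs v.2, abs_nonneg v.1, abs_nonneg v.2]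

@[fun_prop]
lemma Continuous.dot2 {X : Type*} [TopologicalSpace X] {f g : X → ℝ × ℝ}
    (hf : Continuous f) (hg : Continuous g) : Continuous fun x => dot2 (f x) (g x) := by
  unfold _root_.dot2
  fun_prop

lemma ContinuousOn.dot2 {X : Type*} [TopologicalSpace X] {s : Set X} {f g : X → ℝ × ℝ}
    (hf : ContinuousOn f s) (hg : ContinuousOn g s) :
    ContinuousOn (fun x => dot2 (f x) (g x)) s := by
  unfold _root_.dot2
  fun_prop

lemma HasDerivAt.prod_fst {f : ℝ → ℝ × ℝ} {f' : ℝ × ℝ} {t : ℝ} (hf : HasDerivAt f f' t) :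
    HasDerivAt (fun s => (f s).1) f'.1 t :=
  (hasFDerivAt_fst (𝕜 := ℝ) (p := f t)).comp_hasDerivAt t hf

lemma HasDerivAt.prod_snd {f : ℝ → ℝ × ℝ} {f' : ℝ × ℝ} {t : ℝ} (hf : HasDerivAt f f' t) :
    HasDerivAt (fun s => (f s).2) f'.2 t :=
  (hasFDerivAt_snd (𝕜 := ℝ) (p := f t)).comp_hasDerivAt t hf

lemma HasDerivAt.dot2 {f g : ℝ → ℝ × ℝ} {f' g' : ℝ × ℝ} {t : ℝ}
    (hf : HasDerivAt f f' t) (hg : HasDerivAt g g' t) :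
    HasDerivAt (fun s => dot2 (f s) (g s)) (dot2 f' (g t) + dot2 (f t) g') t := by
  have h := ((hf.prod_fst.mul hg.prod_fst).add (hf.prod_snd.mul hg.prod_snd))
  refine h.congr_deriv ?_
  simp only [_root_.dot2]
  ring

lemma isOpen_collisionFree : IsOpen collisionFree := by
  simp only [collisionFree, ofPred_forall]
  refine isOpen_iInter_of_finite fun i => isOpen_iInter_of_finite fun j =>
    isOpen_iInter_of_finite fun _ => ?_
  exact isOpen_ne_fun (continuous_apply i) (continuous_apply j)

lemma continuousOn_force : ContinuousOn force collisionFree := by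
  refine continuousOn_pi.2 fun i => continuousOn_finsetSum _ fun j hj => ?_
  have hd : ContinuousOn (fun c : Fin 4 → ℝ × ℝ => enorm2 (c j - c i) ^ 3) collisionFree := by
    fun_prop
  refine (continuousOn_const.div hd fun c hc => ?_).smul (by fun_prop)
  have := enorm2_pos (sub_ne_zero.2 (hc j i (Finset.ne_of_mem_erase hj)))
  positivity

lemma continuousOn_potential : ContinuousOn potential collisionFree := by
  refine continuousOn_finsetSum _ fun i _ => continuousOn_finsetSum _ fun j hj => ?_
  refine ContinuousOn.inv₀ (by fun_prop) fun c hc => ?_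
  exact (enorm2_pos (sub_ne_zero.2 (hc i j (Finset.mem_filter.1 hj).2.ne))).ne'

@[fun_prop]
lemma continuous_kinetic : Continuous kinetic := by
  unfold kinetic
  fun_prop

lemma hasDerivAt_inv_enorm2 {d e : ℝ × ℝ} {x : ℝ} (h : d + x • e ≠ 0) :
    HasDerivAt (fun y : ℝ => (enorm2 (d + y • e))⁻¹)
      (-(dot2 (d + x • e) e) / enorm2 (d + x • e) ^ 3) x := by
  have hl : HasDerivAt (fun y : ℝ => d + y • e) e x := by
    simpa using ((hasDerivAt_id x).smul_const e).const_add d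
  have hp := enorm2_pos h
  have hs : (d + x • e).1 ^ 2 + (d + x • e).2 ^ 2 ≠ 0 := by
    rw [← enorm2_sq]
    positivity
  have h₁ := ((hl.prod_fst.pow 2).add (hl.prod_snd.pow 2)).sqrt hs
  have h₂ := h₁.inv (show Real.sqrt _ ≠ 0 from hp.ne')
  refine h₂.congr_deriv ?_
  change _ / enorm2 (d + x • e) ^ 2 = _
  change -(_ / (2 * enorm2 (d + x • e))) / enorm2 (d + x • e) ^ 2 = _
  simp only [dot2]
  field_simp
  push_cast
  ring

lemma hasDerivAt_potential {c h : Fin 4 → ℝ × ℝ} {x : ℝ} (hc : c + x • h ∈ collisionFree) :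
    HasDerivAt (fun y : ℝ => potential (c + y • h))
      (∑ i, dot2 (force (c + x • h) i) (h i)) x := by
  have key : HasDerivAt (fun y : ℝ => potential (c + y • h))
      (∑ i : Fin 4, ∑ j ∈ Finset.univ.filter (fun j => i < j),
        -(dot2 ((c + x • h) i - (c + x • h) j) (h i - h j)) /
          enorm2 ((c + x • h) i - (c + x • h) j) ^ 3) x := by
    refine HasDerivAt.fun_sum fun i _ => HasDerivAt.fun_sum fun j hj => ?_
    have e : ∀ y : ℝ, (c + y • h) i - (c + y • h) j = (c i - c j) + y • (h i - h j) := by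
      intro y
      simp only [Pi.add_apply, Pi.smul_apply, smul_sub]
      abel
    simp only [e]
    refine hasDerivAt_inv_enorm2 ?_
    rw [← e]
    exact sub_ne_zero.2 (hc i j (Finset.mem_filter.1 hj).2.ne)
  refine key.congr_deriv ?_
  generalize c + x • h = b
  have hu : (Finset.univ : Finset (Fin 4)) = {0, 1, 2, 3} := rfl
  have e0 : (Finset.univ.erase 0 : Finset (Fin 4)) = {1, 2, 3} := rfl
  have e1 : (Finset.univ.erase 1 : Finset (Fin 4)) = {0, 2, 3} := rfl
  have e2 : (Finset.univ.erase 2 : Finset (Fin 4)) = {0, 1, 3} := rfl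
  have e3 : (Finset.univ.erase 3 : Finset (Fin 4)) = {0, 1, 2} := rfl
  have f0 : (Finset.univ.filter fun j : Fin 4 => 0 < j) = {1, 2, 3} := rfl
  have f1 : (Finset.univ.filter fun j : Fin 4 => 1 < j) = {2, 3} := rfl
  have f2 : (Finset.univ.filter fun j : Fin 4 => 2 < j) = {3} := rfl
  have f3 : (Finset.univ.filter fun j : Fin 4 => 3 < j) = ∅ := rfl
  simp only [Fin.sum_univ_four, force, e0, e1, e2, e3, f0, f1, f2, f3]
  simp [dot2, enorm2_sub_comm (b 1) (b 0), enorm2_sub_comm (b 2) (b 0),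
    enorm2_sub_comm (b 3) (b 0), enorm2_sub_comm (b 2) (b 1), enorm2_sub_comm (b 3) (b 1),
    enorm2_sub_comm (b 3) (b 2)]
  ring

lemma hasDerivAt_kinetic (v w : Fin 4 → ℝ × ℝ) (x : ℝ) :
    HasDerivAt (fun y : ℝ => kinetic (v + y • w)) (∑ i, dot2 ((v + x • w) i) (w i)) x := by
  have key : HasDerivAt (fun y : ℝ => kinetic (v + y • w))
      ((1 / 2) * ∑ i, (2 * dot2 ((v + x • w) i) (w i))) x := by
    refine HasDerivAt.const_mul _ (HasDerivAt.fun_sum fun i _ => ?_)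
    simp only [enorm2_sq]
    have hl : HasDerivAt (fun y : ℝ => (v + y • w) i) (w i) x := by
      simpa using ((hasDerivAt_id x).smul_const (w i)).const_add (v i)
    refine ((hl.prod_fst.pow 2).add (hl.prod_snd.pow 2)).congr_deriv ?_
    simp only [dot2]
    push_cast
    ring
  refine key.congr_deriv ?_
  rw [← Finset.mul_sum]
  ring

/-- A continuously differentiable path on the line, restricted to `[0,1]`. -/
def H1Path4.ofC1 (q v : ℝ → Fin 4 → ℝ × ℝ) (hq : ∀ t, HasDerivAt q (v t) t)
    (hv : Continuous v) : H1Path4 where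
  q := q
  v := v
  hvInt i := by
    have : Continuous fun t => v t i := by fun_prop
    exact this.integrableOn_Icc
  hrep i t _ := by
    have hc : Continuous fun t => v t i := by fun_prop
    rw [intervalIntegral.integral_eq_sub_of_hasDerivAt
      (fun s _ => hasDerivAt_pi.1 (hq s) i) (hc.intervalIntegrable _ _)]
    abel
  hL2 i := by
    have : Continuous fun t => enorm2 (v t i) ^ 2 := by fun_prop
    exact this.integrableOn_Icc

lemma kinetic_nonneg (v : Fin 4 → ℝ × ℝ) : 0 ≤ kinetic v := by
  unfold kinetic
  positivity

lemma potential_nonneg (c : Fin 4 → ℝ × ℝ) : 0 ≤ potential c :=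
  Finset.sum_nonneg fun _ _ => Finset.sum_nonneg fun _ _ => inv_nonneg.2 (enorm2_nonneg _)

lemma ofReal_potential {c : Fin 4 → ℝ × ℝ} (hc : c ∈ collisionFree) :
    ∑ i : Fin 4, ∑ j ∈ Finset.univ.filter (fun j => i < j),
      (ENNReal.ofReal (enorm2 (c i - c j)))⁻¹ = ENNReal.ofReal (potential c) := by
  unfold potential
  rw [ENNReal.ofReal_sum_of_nonneg fun _ _ =>
    Finset.sum_nonneg fun _ _ => inv_nonneg.2 (enorm2_nonneg _)]
  refine Finset.sum_congr rfl fun i _ => ?_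
  rw [ENNReal.ofReal_sum_of_nonneg fun _ _ => inv_nonneg.2 (enorm2_nonneg _)]
  refine Finset.sum_congr rfl fun j hj => ?_
  rw [ENNReal.ofReal_inv_of_pos]
  exact enorm2_pos (sub_ne_zero.2 (hc i j (Finset.mem_filter.1 hj).2.ne))

lemma action_ofC1 {q v : ℝ → Fin 4 → ℝ × ℝ} (hq : ∀ t, HasDerivAt q (v t) t)
    (hv : Continuous v) (hc : ∀ t ∈ Icc (0 : ℝ) 1, q t ∈ collisionFree) :
    action (H1Path4.ofC1 q v hq hv) =
      ENNReal.ofReal (∫ t in (0 : ℝ)..1, (kinetic (v t) + potential (q t))) := by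
  have hqc : Continuous q := continuous_iff_continuousAt.2 fun t => (hq t).continuousAt
  have hL : ContinuousOn (fun t => kinetic (v t) + potential (q t)) (Icc 0 1) :=
    (continuous_kinetic.comp hv).continuousOn.add
      (continuousOn_potential.comp hqc.continuousOn hc)
  rw [intervalIntegral.integral_of_le zero_le_one, ← integral_Icc_eq_integral_Ioc,
    ofReal_integral_eq_lintegral_ofReal hL.integrableOn_Icc
      (ae_of_all _ fun t => add_nonneg (kinetic_nonneg _) (potential_nonneg _))]
  refine setLIntegral_congr_fun measurableSet_Icc fun t ht => ?_
  rw [ENNReal.ofReal_add (kinetic_nonneg _) (potential_nonneg _), ← ofReal_potential (hc t ht)]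
  rfl

lemma lintegral_inv_abs_sub_eq_top {s : ℝ} (hs : s ∈ Icc (0 : ℝ) 1) :
    ∫⁻ t in Icc (0 : ℝ) 1, ‖(t - s)⁻¹‖ₑ = ⊤ := by
  by_contra h
  have hintegral : IntegrableOn (fun t : ℝ => (t - s)⁻¹) (Icc 0 1) :=
    ⟨(measurable_id.sub_const s).inv.aestronglyMeasurable, lt_top_iff_ne_top.2 h⟩
  have h' : IntervalIntegrable (fun t : ℝ => (t - s)⁻¹) volume 0 1 :=
    (intervalIntegrable_iff_integrableOn_Icc_of_le zero_le_one).2 hintegral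
  rw [intervalIntegrable_sub_inv_iff, uIcc_of_le zero_le_one] at h'
  simp [hs] at h'

lemma collisionFree_of_action_ne_top {p : H1Path4} {K : ℝ}
    (hK : ∀ s ∈ Icc (0 : ℝ) 1, ∀ t ∈ Icc (0 : ℝ) 1, ‖p.q t - p.q s‖ ≤ K * |t - s|)
    (hp : action p ≠ ⊤) {s : ℝ} (hs : s ∈ Icc (0 : ℝ) 1) : p.q s ∈ collisionFree := by
  suffices ∀ i j : Fin 4, i < j → p.q s i ≠ p.q s j by
    intro i j hij
    rcases lt_or_gt_of_ne hij with h | h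
    · exact this i j h
    · exact (this j i h).symm
  intro i j hij hcol
  apply hp
  set L : ℝ := 4 * max K 1 with hLdef
  have hL : 0 < L := by positivity
  have bound : ∀ t ∈ Icc (0 : ℝ) 1, enorm2 (p.q t i - p.q t j) ≤ L * |t - s| := by
    intro t ht
    have h₁ : p.q t i - p.q t j = (p.q t - p.q s) i - (p.q t - p.q s) j := by
      simp [hcol]
    have h₂ := (norm_le_pi_norm (p.q t - p.q s) i).trans (hK s hs t ht)
    have h₃ := (norm_le_pi_norm (p.q t - p.q s) j).trans (hK s hs t ht)
    have h₄ := norm_sub_le ((p.q t - p.q s) i) ((p.q t - p.q s) j)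
    have h₅ := enorm2_le_two_mul_norm (p.q t i - p.q t j)
    rw [h₁] at h₅ ⊢
    have h₆ : K * |t - s| ≤ max K 1 * |t - s| := by
      gcongr
      exact le_max_left _ _
    rw [hLdef]
    linarith
  have hle : ∫⁻ t in Icc (0 : ℝ) 1, ENNReal.ofReal L⁻¹ * ‖(t - s)⁻¹‖ₑ ≤ action p := by
    refine setLIntegral_mono' measurableSet_Icc fun t ht => ?_
    refine le_trans ?_ le_add_self
    refine le_trans ?_ (Finset.single_le_sum (fun _ _ => zero_le) (Finset.mem_univ i))
    refine le_trans ?_ (Finset.single_le_sum (fun _ _ => zero_le)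
      (Finset.mem_filter.2 ⟨Finset.mem_univ j, hij⟩))
    rw [← ofReal_norm, ← ENNReal.ofReal_mul (by positivity)]
    rcases eq_or_ne t s with rfl | hts
    · simp
    · have : 0 < |t - s| := abs_pos.2 (sub_ne_zero.2 hts)
      rw [norm_inv, Real.norm_eq_abs, ← mul_inv, ENNReal.ofReal_inv_of_pos (by positivity)]
      exact ENNReal.inv_le_inv.2 (ENNReal.ofReal_le_ofReal (bound t ht))
  rw [lintegral_const_mul' _ _ ENNReal.ofReal_ne_top, lintegral_inv_abs_sub_eq_top hs,
    ENNReal.mul_top (by simpa using hL)] at hle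
  exact top_le_iff.1 hle

lemma rotV_injective (θ : ℝ) : Function.Injective (rotV θ) := by
  intro v w h
  have h₁ := congrArg Prod.fst h
  have h₂ := congrArg Prod.snd h
  simp only [rotV] at h₁ h₂
  have h₃ := Real.sin_sq_add_cos_sq θ
  ext
  · linear_combination (-v.1 + w.1) * h₃ + Real.cos θ * h₁ + Real.sin θ * h₂
  · linear_combination (-v.2 + w.2) * h₃ - Real.sin θ * h₁ + Real.cos θ * h₂

/-- The affine path from a double isosceles configuration to the square, before rotation. -/
def squarePath (t : ℝ) : Fin 4 → ℝ × ℝ :=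
  ![(-2 + t, -t), (-1, t), (3 / 2 - t / 2, 1), (3 / 2 - t / 2, -1)]

lemma squarePath_mem_collisionFree {t : ℝ} (ht : t ∈ Icc (0 : ℝ) 1) :
    squarePath t ∈ collisionFree := by
  obtain ⟨h₀, h₁⟩ := ht
  intro i j hij
  rw [Ne, Prod.ext_iff, not_and_or]
  fin_cases i <;> fin_cases j <;> simp [squarePath] at hij ⊢ <;> grind

lemma exists_admissible_action_ne_top {θ : ℝ} {E : Set (Fin 4 → ℝ × ℝ)}
    (hE : E = QE1set θ ∨ E = QE2set θ) : ∃ p : H1Path4, inAdm E p ∧ action p ≠ ⊤ := by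
  let q : ℝ → Fin 4 → ℝ × ℝ := fun t i => rotV (θ * t) (squarePath t i)
  have hq : ContDiff ℝ 1 q := by
    refine contDiff_pi.2 fun i => ?_
    fin_cases i <;> simp [q, rotV, squarePath] <;> fun_prop
  refine ⟨H1Path4.ofC1 q (deriv q)
    (fun t => (hq.differentiable one_ne_zero t).hasDerivAt) hq.continuous_deriv_one,
    ⟨?_, ?_, ?_⟩, ?_⟩
  · intro t _
    change ∑ i, q t i = 0
    ext <;> simp [q, rotV, squarePath, Fin.sum_univ_four] <;> ring
  · refine ⟨1, 1, 1, zero_le_one, zero_le_one, ?_⟩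
    change q 0 = _
    funext i
    fin_cases i <;> simp [q, rotV, squarePath] <;> norm_num
  · change q 1 ∈ E
    rcases hE with rfl | rfl <;> refine ⟨1, 1, 1, zero_le_one, zero_le_one, ?_⟩ <;> funext i <;>
      fin_cases i <;> simp [q, rotV, squarePath] <;> norm_num
  · rw [action_ofC1]
    · exact ENNReal.ofReal_ne_top
    · intro t ht i j hij h
      exact squarePath_mem_collisionFree ht i j hij (rotV_injective _ h)

lemma exists_C1_representative (p : H1Path4) (hreg : ContDiffOn ℝ 1 p.q (Icc (0 : ℝ) 1)) :
    ∃ (q v : ℝ → Fin 4 → ℝ × ℝ) (hq : ∀ t, HasDerivAt q (v t) t) (hv : Continuous v),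
      EqOn q p.q (Icc 0 1) ∧ action p = action (H1Path4.ofC1 q v hq hv) := by
  have hu : UniqueDiffOn ℝ (Icc (0 : ℝ) 1) := uniqueDiffOn_Icc zero_lt_one
  let w := derivWithin p.q (Icc (0 : ℝ) 1)
  have hw : ContinuousOn w (Icc 0 1) := hreg.continuousOn_derivWithin hu le_rfl
  let v : ℝ → Fin 4 → ℝ × ℝ := fun t => w (projIcc 0 1 zero_le_one t)
  have hv : Continuous v := hw.comp_continuous
    (continuous_subtype_val.comp continuous_projIcc) fun t => (projIcc 0 1 zero_le_one t).2
  have hvw : EqOn v w (Icc 0 1) := by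
    intro t ht
    simp only [v, projIcc_of_mem _ ht]
  let q : ℝ → Fin 4 → ℝ × ℝ := fun t => p.q 0 + ∫ s in (0 : ℝ)..t, v s
  have hq : ∀ t, HasDerivAt q (v t) t := fun t =>
    (intervalIntegral.integral_hasDerivAt_right (hv.intervalIntegrable _ _)
      (hv.stronglyMeasurableAtFilter _ _) hv.continuousAt).const_add _
  have hqp : EqOn q p.q (Icc 0 1) := by
    intro t ht
    have : ∫ s in (0 : ℝ)..t, v s = p.q t - p.q 0 := by
      refine intervalIntegral.integral_eq_sub_of_hasDerivAt_of_le ht.1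
        (hreg.continuousOn.mono (Icc_subset_Icc_right ht.2)) (fun s hs => ?_)
        (hv.intervalIntegrable _ _)
      have hs' : s ∈ Ioo (0 : ℝ) 1 := ⟨hs.1, hs.2.trans_le ht.2⟩
      rw [hvw (Ioo_subset_Icc_self hs')]
      exact ((hreg.differentiableOn one_ne_zero s
        (Ioo_subset_Icc_self hs')).hasDerivWithinAt).hasDerivAt (Icc_mem_nhds hs'.1 hs'.2)
    simp only [q, this]
    abel
  refine ⟨q, v, hq, hv, hqp, ?_⟩
  have hae : ∀ i : Fin 4, ∀ᵐ t, t ∈ Icc (0 : ℝ) 1 → p.v t i = v t i := by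
    intro i
    have hI : IntervalIntegrable (fun t => p.v t i) volume 0 1 :=
      (intervalIntegrable_iff_integrableOn_Icc_of_le zero_le_one).2 (p.hvInt i)
    have h₀ : ∀ᵐ t : ℝ, t ≠ 0 := by simp [ae_iff, measure_singleton]
    have h₁ : ∀ᵐ t : ℝ, t ≠ 1 := by simp [ae_iff, measure_singleton]
    filter_upwards [hI.ae_hasDerivAt_integral, h₀, h₁] with t ht ht0 ht1 htI
    rw [uIcc_of_le zero_le_one] at ht
    have hd := (ht htI 0 (by simp)).const_add (p.q 0 i)
    have hd' := hasDerivAt_pi.1 (hq t) i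
    refine hd.unique (hd'.congr_of_eventuallyEq ?_)
    filter_upwards [Icc_mem_nhds (lt_of_le_of_ne htI.1 ht0.symm) (lt_of_le_of_ne htI.2 ht1)]
      with s hs
    rw [hqp hs, p.hrep i s hs]
  refine setLIntegral_congr_fun_ae measurableSet_Icc ?_
  filter_upwards [ae_all_iff.2 hae] with t ht htI
  have hvt : p.v t = v t := funext fun i => ht i htI
  change _ = ENNReal.ofReal ((1 / 2) * ∑ i, enorm2 (v t i) ^ 2) + ∑ i : Fin 4, _
  rw [hvt]
  simp only [H1Path4.ofC1, hqp htI]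

lemma hasDerivAt_action_integral {q v h w : ℝ → Fin 4 → ℝ × ℝ} (hq : Continuous q)
    (hv : Continuous v) (hh : Continuous h) (hw : Continuous w)
    (hc : ∀ᶠ x in nhds (0 : ℝ), ∀ t ∈ Icc (0 : ℝ) 1, q t + x • h t ∈ collisionFree) :
    HasDerivAt (fun x : ℝ => ∫ t in (0 : ℝ)..1,
        (kinetic (v t + x • w t) + potential (q t + x • h t)))
      (∫ t in (0 : ℝ)..1, (∑ i, dot2 (v t i) (w t i) + ∑ i, dot2 (force (q t) i) (h t i))) 0 := by
  obtain ⟨r, hr, hball⟩ := Metric.eventually_nhds_iff_ball.1 hc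
  have hIoc : uIoc (0 : ℝ) 1 ⊆ Icc 0 1 := by
    rw [uIoc_of_le zero_le_one]
    exact Ioc_subset_Icc_self
  let Φ : ℝ → ℝ → ℝ := fun x t => kinetic (v t + x • w t) + potential (q t + x • h t)
  let Φ' : ℝ → ℝ → ℝ := fun x t => ∑ i, dot2 ((v t + x • w t) i) (w t i) +
    ∑ i, dot2 (force (q t + x • h t) i) (h t i)
  have hΦ : ∀ x ∈ Metric.ball (0 : ℝ) r, ContinuousOn (Φ x) (Icc 0 1) := by
    intro x hx
    refine ContinuousOn.add ?_ (continuousOn_potential.comp (by fun_prop) (hball x hx))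
    exact (by fun_prop : Continuous fun t => kinetic (v t + x • w t)).continuousOn
  have hΦ' : ContinuousOn (fun z : ℝ × ℝ => Φ' z.1 z.2) (Metric.closedBall 0 (r / 2) ×ˢ Icc 0 1) := by
    refine ContinuousOn.add ?_ (continuousOn_finsetSum _ fun i _ => ContinuousOn.dot2 ?_ ?_)
    · exact (by fun_prop : Continuous fun z : ℝ × ℝ =>
        ∑ i, dot2 ((v z.2 + z.1 • w z.2) i) (w z.2 i)).continuousOn
    · refine continuousOn_pi.1 (continuousOn_force.comp
        (f := fun z : ℝ × ℝ => q z.2 + z.1 • h z.2) (by fun_prop) ?_) i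
      intro z hz
      exact hball z.1 (Metric.closedBall_subset_ball (by linarith) hz.1) z.2 hz.2
    · exact (by fun_prop : Continuous fun z : ℝ × ℝ => h z.2 i).continuousOn
  obtain ⟨C, hC⟩ := ((isCompact_closedBall (0 : ℝ) (r / 2)).prod
    (isCompact_Icc (a := (0 : ℝ)) (b := 1))).exists_bound_of_continuousOn hΦ'
  have hΦ'0 : ContinuousOn (Φ' 0) (Icc 0 1) :=
    hΦ'.comp (f := fun t : ℝ => ((0 : ℝ), t)) (by fun_prop)
      fun t ht => ⟨Metric.mem_closedBall_self (by positivity), ht⟩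
  have hsub : ∀ x ∈ Metric.ball (0 : ℝ) (r / 2), x ∈ Metric.ball (0 : ℝ) r :=
    fun x hx => Metric.ball_subset_ball (by linarith) hx
  have key := (intervalIntegral.hasDerivAt_integral_of_dominated_loc_of_deriv_le
    (μ := volume) (F := Φ) (F' := Φ') (x₀ := 0) (a := 0) (b := 1) (bound := fun _ => C)
    (Metric.ball_mem_nhds (0 : ℝ) (half_pos hr)) ?_ ?_ ?_ ?_ ?_ ?_).2
  · simpa [Φ, Φ'] using key
  · filter_upwards [Metric.ball_mem_nhds (0 : ℝ) hr] with x hx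
    exact ((hΦ x hx).mono hIoc).aestronglyMeasurable measurableSet_uIoc
  · refine ContinuousOn.intervalIntegrable ?_
    rw [uIcc_of_le zero_le_one]
    exact hΦ 0 (Metric.mem_ball_self hr)
  · exact (hΦ'0.mono hIoc).aestronglyMeasurable measurableSet_uIoc
  · exact ae_of_all _ fun t ht x hx =>
      hC (x, t) ⟨Metric.ball_subset_closedBall hx, hIoc ht⟩
  · exact intervalIntegrable_const
  · exact ae_of_all _ fun t ht x hx => (hasDerivAt_kinetic (v t) (w t) x).add
      (hasDerivAt_potential (hball x (hsub x hx) t (hIoc ht)))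

/-- The linear span of the boundary configurations `Q_S`. -/
def spanQS : Set (Fin 4 → ℝ × ℝ) :=
  { c | ∃ a b d : ℝ, c = ![(-a - d, 0), (-a, 0), ((2 * a + d) / 2, b), ((2 * a + d) / 2, -b)] }

lemma eventually_add_smul_mem_QSset {c h : Fin 4 → ℝ × ℝ} (hc : c ∈ QSset)
    (hcf : c ∈ collisionFree) (hh : h ∈ spanQS) :
    ∀ᶠ x in nhds (0 : ℝ), c + x • h ∈ QSset := by
  obtain ⟨a, b, d, hb, hd, rfl⟩ := hc
  obtain ⟨a', b', d', rfl⟩ := hh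
  have hb0 : b ≠ 0 := by
    rintro rfl
    exact hcf 2 3 (by decide) (by simp)
  have hd0 : d ≠ 0 := by
    rintro rfl
    exact hcf 0 1 (by decide) (by simp)
  have hb1 : ∀ᶠ x in nhds (0 : ℝ), 0 < b + x * b' :=
    (by fun_prop : Continuous fun x : ℝ => b + x * b').continuousAt.eventually
      (lt_mem_nhds (by simpa using lt_of_le_of_ne hb hb0.symm))
  have hd1 : ∀ᶠ x in nhds (0 : ℝ), 0 < d + x * d' :=
    (by fun_prop : Continuous fun x : ℝ => d + x * d').continuousAt.eventually
      (lt_mem_nhds (by simpa using lt_of_le_of_ne hd hd0.symm))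
  filter_upwards [hb1, hd1] with x hx hx'
  refine ⟨a + x * a', b + x * b', d + x * d', hx.le, hx'.le, ?_⟩
  funext i
  fin_cases i <;> ext <;> simp <;> ring

lemma first_variation_eq_zero {E : Set (Fin 4 → ℝ × ℝ)} {q v h w : ℝ → Fin 4 → ℝ × ℝ}
    (hq : ∀ t, HasDerivAt q (v t) t) (hv : Continuous v)
    (hh : ∀ t, HasDerivAt h (w t) t) (hw : Continuous w)
    (hmin : isMin E (H1Path4.ofC1 q v hq hv))
    (hc : ∀ t ∈ Icc (0 : ℝ) 1, q t ∈ collisionFree)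
    (hsum : ∀ t ∈ Icc (0 : ℝ) 1, ∑ i, h t i = 0) (h0 : h 0 ∈ spanQS) (h1 : h 1 = 0) :
    ∫ t in (0 : ℝ)..1,
      (∑ i, dot2 (v t i) (w t i) + ∑ i, dot2 (force (q t) i) (h t i)) = 0 := by
  have hqc : Continuous q := continuous_iff_continuousAt.2 fun t => (hq t).continuousAt
  have hhc : Continuous h := continuous_iff_continuousAt.2 fun t => (hh t).continuousAt
  have hev : ∀ᶠ x in nhds (0 : ℝ), ∀ t ∈ Icc (0 : ℝ) 1, q t + x • h t ∈ collisionFree := by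
    refine isCompact_Icc.eventually_forall_of_forall_eventually fun t ht => ?_
    refine (by fun_prop : Continuous fun z : ℝ × ℝ => q z.2 + z.1 • h z.2).continuousAt.eventually
      (isOpen_collisionFree.mem_nhds ?_)
    simpa using hc t ht
  refine IsLocalMin.hasDerivAt_eq_zero ?_ (hasDerivAt_action_integral hqc hv hhc hw hev)
  obtain ⟨⟨hchi, hS, hend⟩, hle⟩ := hmin
  filter_upwards [hev, eventually_add_smul_mem_QSset hS (hc 0 (by simp)) h0] with x hx hxS
  have hd : ∀ t, HasDerivAt (fun t => q t + x • h t) (v t + x • w t) t :=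
    fun t => (hq t).add ((hh t).const_smul x)
  have hle' := hle (H1Path4.ofC1 (fun t => q t + x • h t) (fun t => v t + x • w t) hd
    (by fun_prop)) ⟨?_, hxS, ?_⟩
  · rw [action_ofC1 _ _ hc, action_ofC1 _ _ hx, ENNReal.ofReal_le_ofReal_iff] at hle'
    · simpa using hle'
    · exact intervalIntegral.integral_nonneg zero_le_one fun t _ =>
        add_nonneg (kinetic_nonneg _) (potential_nonneg _)
  · intro t ht
    change ∑ i, (q t i + x • h t i) = 0
    rw [Finset.sum_add_distrib, ← Finset.smul_sum, hsum t ht, show ∑ i, q t i = 0 from hchi t ht]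
    simp
  · change q 1 + x • h 1 ∈ E
    rw [h1, smul_zero, add_zero]
    exact hend

lemma sum_force (c : Fin 4 → ℝ × ℝ) : ∑ i, force c i = 0 := by
  have e0 : (Finset.univ.erase 0 : Finset (Fin 4)) = {1, 2, 3} := rfl
  have e1 : (Finset.univ.erase 1 : Finset (Fin 4)) = {0, 2, 3} := rfl
  have e2 : (Finset.univ.erase 2 : Finset (Fin 4)) = {0, 1, 3} := rfl
  have e3 : (Finset.univ.erase 3 : Finset (Fin 4)) = {0, 1, 2} := rfl
  simp only [Fin.sum_univ_four, force, e0, e1, e2, e3]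
  ext <;> simp [enorm2_sub_comm (c 1) (c 0), enorm2_sub_comm (c 2) (c 0),
    enorm2_sub_comm (c 3) (c 0), enorm2_sub_comm (c 2) (c 1), enorm2_sub_comm (c 3) (c 1),
    enorm2_sub_comm (c 3) (c 2)] <;> ring

lemma hasDerivAt_sum_dot2 {f g : ℝ → Fin 4 → ℝ × ℝ} {f' g' : Fin 4 → ℝ × ℝ} {t : ℝ}
    (hf : HasDerivAt f f' t) (hg : HasDerivAt g g' t) :
    HasDerivAt (fun s => ∑ i, dot2 (f s i) (g s i))
      (∑ i, dot2 (f t i) (g' i) + ∑ i, dot2 (f' i) (g t i)) t := by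
  refine (HasDerivAt.fun_sum (u := Finset.univ) fun (i : Fin 4) _ =>
    (hasDerivAt_pi.1 hf i).dot2 (hasDerivAt_pi.1 hg i)).congr_deriv ?_
  rw [Finset.sum_add_distrib, add_comm]

lemma hasDerivAt_primitive {f : ℝ → Fin 4 → ℝ × ℝ} (hf : Continuous f) (t : ℝ) :
    HasDerivAt (fun t => ∫ s in (0 : ℝ)..t, f s) (f t) t :=
  intervalIntegral.integral_hasDerivAt_right (hf.intervalIntegrable _ _)
    (hf.stronglyMeasurableAtFilter _ _) hf.continuousAt

lemma sum_primitive_eq_zero {f : ℝ → Fin 4 → ℝ × ℝ} (hf : Continuous f)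
    (h0 : ∀ t, ∑ i, f t i = 0) (t : ℝ) : ∑ i, (∫ s in (0 : ℝ)..t, f s) i = 0 := by
  let S : (Fin 4 → ℝ × ℝ) →L[ℝ] ℝ × ℝ :=
    ∑ i, ContinuousLinearMap.proj (R := ℝ) (φ := fun _ : Fin 4 => ℝ × ℝ) i
  have hS : ∀ c, S c = ∑ i, c i := fun c => by simp [S]
  rw [← hS, ← ContinuousLinearMap.intervalIntegral_comp_comm S (hf.intervalIntegrable _ _)]
  simp [hS, h0]

lemma eq_zero_of_sum_dot2_self {c : Fin 4 → ℝ × ℝ} (h : ∑ i, dot2 (c i) (c i) ≤ 0) : c = 0 := by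
  have hnn : ∀ i, 0 ≤ dot2 (c i) (c i) := fun i => by
    unfold dot2
    nlinarith [sq_nonneg (c i).1, sq_nonneg (c i).2]
  funext i
  have hi := (Finset.single_le_sum (fun j _ => hnn j) (Finset.mem_univ i)).trans h
  unfold dot2 at hi
  ext <;> simp <;> nlinarith [sq_nonneg (c i).1, sq_nonneg (c i).2]

lemma zero_mem_spanQS : (0 : Fin 4 → ℝ × ℝ) ∈ spanQS := by
  refine ⟨0, 0, 0, ?_⟩
  funext i
  fin_cases i <;> ext <;> simp

lemma sum_eq_zero_of_mem_spanQS {c : Fin 4 → ℝ × ℝ} (hc : c ∈ spanQS) : ∑ i, c i = 0 := by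
  obtain ⟨a, b, d, rfl⟩ := hc
  ext <;> simp [Fin.sum_univ_four]
  ring

/-- A collision-free minimizer solves the Newtonian equations up to the endpoints, and its initial
velocity is orthogonal to the space of boundary configurations. -/
lemma exists_newton_solution {E : Set (Fin 4 → ℝ × ℝ)} {q v : ℝ → Fin 4 → ℝ × ℝ}
    (hq : ∀ t, HasDerivAt q (v t) t) (hv : Continuous v)
    (hmin : isMin E (H1Path4.ofC1 q v hq hv))
    (hc : ∀ t ∈ Icc (0 : ℝ) 1, q t ∈ collisionFree) :
    ∃ x u f : ℝ → Fin 4 → ℝ × ℝ, (∀ t, HasDerivAt x (u t) t) ∧ (∀ t, HasDerivAt u (f t) t) ∧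
      Continuous f ∧ EqOn x q (Icc 0 1) ∧ (∀ t ∈ Icc (0 : ℝ) 1, f t = force (q t)) ∧
      ∑ i, u 0 i = 0 ∧ ∀ τ ∈ spanQS, ∑ i, dot2 (u 0 i) (τ i) = 0 := by
  have hqc : Continuous q := continuous_iff_continuousAt.2 fun t => (hq t).continuousAt
  let f : ℝ → Fin 4 → ℝ × ℝ := fun t => force (q (projIcc 0 1 zero_le_one t))
  have hf : Continuous f := continuousOn_force.comp_continuous
    (hqc.comp (continuous_subtype_val.comp continuous_projIcc))
    fun t => hc _ (projIcc 0 1 zero_le_one t).2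
  have hfq : ∀ t ∈ Icc (0 : ℝ) 1, f t = force (q t) := by
    intro t ht
    simp only [f, projIcc_of_mem _ ht]
  let G : ℝ → Fin 4 → ℝ × ℝ := fun t => ∫ s in (0 : ℝ)..t, f s
  have hG : ∀ t, HasDerivAt G (f t) t := hasDerivAt_primitive hf
  have hGc : Continuous G := continuous_iff_continuousAt.2 fun t => (hG t).continuousAt
  have hG0 : G 0 = 0 := intervalIntegral.integral_same
  have hGs : ∀ t, ∑ i, G t i = 0 := sum_primitive_eq_zero hf fun t => sum_force _
  let H : ℝ → Fin 4 → ℝ × ℝ := fun t => ∫ s in (0 : ℝ)..t, G s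
  have hH : ∀ t, HasDerivAt H (G t) t := hasDerivAt_primitive hGc
  have hH0 : H 0 = 0 := intervalIntegral.integral_same
  have hHs : ∀ t, ∑ i, H t i = 0 := sum_primitive_eq_zero hGc hGs
  let m : Fin 4 → ℝ × ℝ := q 1 - q 0 - H 1
  have hchi : ∀ t ∈ Icc (0 : ℝ) 1, ∑ i, q t i = 0 := hmin.1.1
  have hms : ∑ i, m i = 0 := by
    simp only [m, Pi.sub_apply, Finset.sum_sub_distrib, hHs, hchi 0 (by simp), hchi 1 (by simp)]
    simp
  let u : ℝ → Fin 4 → ℝ × ℝ := fun t => G t + m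
  have hu : ∀ t, HasDerivAt u (f t) t := fun t => (hG t).add_const m
  have huc : Continuous u := continuous_iff_continuousAt.2 fun t => (hu t).continuousAt
  let x : ℝ → Fin 4 → ℝ × ℝ := fun t => q 0 + (H t + t • m)
  have hx : ∀ t, HasDerivAt x (u t) t := fun t => by
    refine (((hH t).add ((hasDerivAt_id t).smul_const m)).const_add (q 0)).congr_deriv ?_
    rw [one_smul]
  let h : ℝ → Fin 4 → ℝ × ℝ := fun t => q t - x t
  let w : ℝ → Fin 4 → ℝ × ℝ := fun t => v t - u t
  have hh : ∀ t, HasDerivAt h (w t) t := fun t => (hq t).sub (hx t)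
  have hw : Continuous w := hv.sub huc
  have hhc : Continuous h := continuous_iff_continuousAt.2 fun t => (hh t).continuousAt
  have hh0 : h 0 = 0 := by simp [h, x, hH0]
  have hh1 : h 1 = 0 := by simp [h, x, m]
  have hhs : ∀ t ∈ Icc (0 : ℝ) 1, ∑ i, h t i = 0 := by
    intro t ht
    simp only [h, x, Pi.sub_apply, Pi.add_apply, Pi.smul_apply, Finset.sum_sub_distrib,
      Finset.sum_add_distrib, ← Finset.smul_sum, hHs, hms, hchi 0 (by simp), hchi t ht]
    simp
  have hvar := first_variation_eq_zero hq hv hh hw hmin hc hhs (hh0 ▸ zero_mem_spanQS) hh1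
  have hparts : ∫ t in (0 : ℝ)..1,
      (∑ i, dot2 (u t i) (w t i) + ∑ i, dot2 (f t i) (h t i)) = 0 := by
    rw [intervalIntegral.integral_eq_sub_of_hasDerivAt
      (fun t _ => hasDerivAt_sum_dot2 (hu t) (hh t))
      ((by fun_prop : Continuous fun t => _).intervalIntegrable _ _)]
    simp [hh0, hh1, dot2]
  have hvar' : ∫ t in (0 : ℝ)..1,
      (∑ i, dot2 (v t i) (w t i) + ∑ i, dot2 (f t i) (h t i)) = 0 := by
    refine (intervalIntegral.integral_congr fun t ht => ?_).trans hvar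
    rw [uIcc_of_le zero_le_one] at ht
    simp only [hfq t ht]
  have hww : ∫ t in (0 : ℝ)..1, ∑ i, dot2 (w t i) (w t i) = 0 := by
    have hdiff := congrArg₂ (· - ·) hvar' hparts
    simp only [sub_zero] at hdiff
    rw [← intervalIntegral.integral_sub
      ((by fun_prop : Continuous fun t => _).intervalIntegrable _ _)
      ((by fun_prop : Continuous fun t => _).intervalIntegrable _ _)] at hdiff
    refine (intervalIntegral.integral_congr fun t _ => ?_).trans hdiff
    simp only [add_sub_add_right_eq_sub, ← Finset.sum_sub_distrib]
    refine Finset.sum_congr rfl fun i _ => ?_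
    simp only [w, dot2, Pi.sub_apply, Prod.fst_sub, Prod.snd_sub]
    ring
  have hw0 : ∀ t ∈ Icc (0 : ℝ) 1, w t = 0 := by
    intro t ht
    refine eq_zero_of_sum_dot2_self (le_of_not_gt fun hpos => ?_)
    refine (intervalIntegral.integral_pos zero_lt_one
      (by fun_prop : Continuous fun t => ∑ i, dot2 (w t i) (w t i)).continuousOn
      (fun s _ => Finset.sum_nonneg fun i _ => ?_) ⟨t, ht, hpos⟩).ne' hww
    unfold dot2
    nlinarith [sq_nonneg (w s i).1, sq_nonneg (w s i).2]
  have hxq : EqOn x q (Icc 0 1) := by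
    intro t ht
    have hintegral : ∫ s in (0 : ℝ)..t, w s = h t - h 0 :=
      intervalIntegral.integral_eq_sub_of_hasDerivAt (fun s _ => hh s) (hw.intervalIntegrable _ _)
    have hzero : ∫ s in (0 : ℝ)..t, w s = 0 := by
      refine intervalIntegral.integral_zero_ae (ae_of_all _ fun s hs => hw0 s ?_)
      rw [uIoc_of_le ht.1] at hs
      exact ⟨hs.1.le, hs.2.trans ht.2⟩
    rw [hzero, hh0, sub_zero] at hintegral
    exact (sub_eq_zero.1 hintegral.symm).symm
  have hu0 : u 0 = m := by simp [u, hG0]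
  refine ⟨x, u, f, hx, hu, hf, hxq, hfq, hu0 ▸ hms, fun τ hτ => ?_⟩
  have hk : ∀ t : ℝ, HasDerivAt (fun t : ℝ => (1 - t) • τ) (-τ) t := fun t => by
    simpa using ((hasDerivAt_id t).const_sub 1).smul_const τ
  have hvarτ := first_variation_eq_zero hq hv hk continuous_const hmin hc
    (fun t _ => by
      simp only [Pi.smul_apply, ← Finset.smul_sum, sum_eq_zero_of_mem_spanQS hτ, smul_zero])
    (by simpa using hτ) (by simp)
  have hpartsτ : ∫ t in (0 : ℝ)..1, (∑ i, dot2 (v t i) ((-τ) i) +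
      ∑ i, dot2 (force (q t) i) (((1 - t) • τ) i)) = -∑ i, dot2 (u 0 i) (τ i) := by
    have hcongr : ∫ t in (0 : ℝ)..1, (∑ i, dot2 (v t i) ((-τ) i) +
        ∑ i, dot2 (force (q t) i) (((1 - t) • τ) i)) =
        ∫ t in (0 : ℝ)..1, (∑ i, dot2 (u t i) ((-τ) i) +
          ∑ i, dot2 (f t i) (((1 - t) • τ) i)) := by
      refine intervalIntegral.integral_congr fun t ht => ?_
      rw [uIcc_of_le zero_le_one] at ht
      simp only [hfq t ht, sub_eq_zero.1 (hw0 t ht)]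
    rw [hcongr, intervalIntegral.integral_eq_sub_of_hasDerivAt
      (fun t _ => hasDerivAt_sum_dot2 (hu t) (hk t))
      ((by fun_prop : Continuous fun t => _).intervalIntegrable _ _)]
    simp [dot2]
  rw [hvarτ] at hpartsτ
  linarith

section Glue

variable {V : Type*} [NormedAddCommGroup V] [NormedSpace ℝ V]

/-- Extension of a path to negative times by time reversal composed with a linear map. -/
def glue (S : V →L[ℝ] V) (f : ℝ → V) (t : ℝ) : V := if 0 ≤ t then f t else S (f (-t))

lemma continuous_glue {S : V →L[ℝ] V} {f : ℝ → V} (hf : Continuous f) (h0 : S (f 0) = f 0) :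
    Continuous (glue S f) := by
  refine Continuous.if_le hf (by fun_prop) continuous_const continuous_id ?_
  rintro t rfl
  simp [h0]

lemma hasDerivAt_glue {S : V →L[ℝ] V} {f f' : ℝ → V} (hf : ∀ t, HasDerivAt f (f' t) t)
    (h0 : S (f 0) = f 0) (h0' : -S (f' 0) = f' 0) (t : ℝ) :
    HasDerivAt (glue S f) (glue (-S) f' t) t := by
  have hrev : ∀ s, HasDerivAt (fun s => S (f (-s))) (-S (f' (-s))) s := fun s => by
    have h₁ : HasDerivAt (fun s => f (-s)) (-f' (-s)) s := by
      refine ((hf (-s)).scomp s (hasDerivAt_neg s)).congr_deriv ?_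
      rw [neg_one_smul]
    refine (S.hasFDerivAt.comp_hasDerivAt s h₁).congr_deriv ?_
    rw [map_neg]
  rcases lt_trichotomy t 0 with ht | rfl | ht
  · have hd : glue (-S) f' t = -S (f' (-t)) := if_neg (not_le.2 ht)
    rw [hd]
    refine (hrev t).congr_of_eventuallyEq ?_
    filter_upwards [gt_mem_nhds ht] with s hs
    exact if_neg (not_le.2 hs)
  · have hd : glue (-S) f' 0 = f' 0 := if_pos le_rfl
    rw [hd]
    have hright : HasDerivWithinAt (glue S f) (f' 0) (Ici 0) 0 :=
      (hf 0).hasDerivWithinAt.congr (fun s hs => if_pos hs) (if_pos le_rfl)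
    have hleft : HasDerivWithinAt (glue S f) (f' 0) (Iic 0) 0 := by
      have h₁ := (hrev 0).hasDerivWithinAt (s := Iic 0)
      rw [neg_zero, h0'] at h₁
      refine h₁.congr (fun s hs => ?_) ?_
      · rcases eq_or_lt_of_le (show s ≤ 0 from hs) with rfl | hs
        · simp [glue, h0]
        · exact if_neg (not_le.2 hs)
      · simp [glue, h0]
    rw [← hasDerivWithinAt_univ, ← Iic_union_Ici (a := (0 : ℝ))]
    exact hleft.union hright
  · have hd : glue (-S) f' t = f' t := if_pos ht.le
    rw [hd]
    refine (hf t).congr_of_eventuallyEq ?_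
    filter_upwards [lt_mem_nhds ht] with s hs
    exact if_pos hs.le

end Glue

/-- The symmetry of the four-body problem given by reflection in the horizontal axis and exchange
of the last two bodies. -/
def reflection : (Fin 4 → ℝ × ℝ) →L[ℝ] (Fin 4 → ℝ × ℝ) :=
  ContinuousLinearMap.pi fun i =>
    ((ContinuousLinearMap.fst ℝ ℝ ℝ).prod (-ContinuousLinearMap.snd ℝ ℝ ℝ)).comp
      (ContinuousLinearMap.proj ((![0, 1, 3, 2] : Fin 4 → Fin 4) i))

lemma reflection_apply (c : Fin 4 → ℝ × ℝ) (i : Fin 4) :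
    reflection c i = ((c ((![0, 1, 3, 2] : Fin 4 → Fin 4) i)).1,
      -(c ((![0, 1, 3, 2] : Fin 4 → Fin 4) i)).2) := rfl

lemma reflection_of_mem_QSset {c : Fin 4 → ℝ × ℝ} (hc : c ∈ QSset) : reflection c = c := by
  obtain ⟨a, b, d, _, _, rfl⟩ := hc
  funext i
  fin_cases i <;> simp [reflection_apply]

lemma reflection_mem_collisionFree {c : Fin 4 → ℝ × ℝ} (hc : c ∈ collisionFree) :
    reflection c ∈ collisionFree := by
  intro i j hij h
  have hσ : Function.Injective (![0, 1, 3, 2] : Fin 4 → Fin 4) := by decide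
  rw [reflection_apply, reflection_apply, Prod.mk.injEq, neg_inj] at h
  exact hc _ _ (hσ.ne hij) (Prod.ext h.1 h.2)

lemma force_reflection (c : Fin 4 → ℝ × ℝ) : force (reflection c) = reflection (force c) := by
  have he : ∀ i j, enorm2 (reflection c i - reflection c j) =
      enorm2 (c ((![0, 1, 3, 2] : Fin 4 → Fin 4) i) -
        c ((![0, 1, 3, 2] : Fin 4 → Fin 4) j)) := by
    intro i j
    simp only [enorm2, reflection_apply, Prod.mk_sub_mk, Prod.fst_sub, Prod.snd_sub]
    congr 1
    ring
  have e0 : (Finset.univ.erase 0 : Finset (Fin 4)) = {1, 2, 3} := rfl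
  have e1 : (Finset.univ.erase 1 : Finset (Fin 4)) = {0, 2, 3} := rfl
  have e2 : (Finset.univ.erase 2 : Finset (Fin 4)) = {0, 1, 3} := rfl
  have e3 : (Finset.univ.erase 3 : Finset (Fin 4)) = {0, 1, 2} := rfl
  funext i
  rw [reflection_apply]
  simp only [force, he]
  fin_cases i <;> ext <;> simp [e0, e1, e2, e3, reflection_apply] <;> ring

lemma neg_reflection_of_orthogonal {c : Fin 4 → ℝ × ℝ} (hsum : ∑ i, c i = 0)
    (horth : ∀ τ ∈ spanQS, ∑ i, dot2 (c i) (τ i) = 0) : (-reflection) c = c := by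
  have h₁ := horth _ ⟨1, 0, 0, rfl⟩
  have h₂ := horth _ ⟨0, 1, 0, rfl⟩
  have h₃ := horth _ ⟨0, 0, 1, rfl⟩
  have h₄ := congrArg Prod.fst hsum
  simp [Fin.sum_univ_four, dot2] at h₁ h₂ h₃ h₄
  have k₀ : (c 0).1 = 0 := by linarith
  have k₁ : (c 1).1 = 0 := by linarith
  have k₂ : (c 2).1 = -(c 3).1 := by linarith
  have k₃ : (c 2).2 = (c 3).2 := by linarith
  funext i
  rw [neg_apply, Pi.neg_apply, reflection_apply]
  fin_cases i <;> ext <;> simp [k₀, k₁, k₂, k₃]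

lemma glue_solution {x u f : ℝ → Fin 4 → ℝ × ℝ} (hx : ∀ t, HasDerivAt x (u t) t)
    (hu : ∀ t, HasDerivAt u (f t) t) (hf : Continuous f)
    (hfx : ∀ t ∈ Ico (0 : ℝ) 1, f t = force (x t)) (hx0 : reflection (x 0) = x 0)
    (hu0 : (-reflection) (u 0) = u 0) :
    ContDiff ℝ 2 (glue reflection x) ∧ newton (glue reflection x) (Ioo (-1) 1) := by
  have hf0 : reflection (f 0) = f 0 := by
    rw [hfx 0 (by simp), ← force_reflection, hx0]
  have hd₁ : ∀ t, HasDerivAt (glue reflection x) (glue (-reflection) u t) t :=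
    hasDerivAt_glue hx hx0 hu0
  have hd₂ : ∀ t, HasDerivAt (glue (-reflection) u) (glue reflection f t) t := fun t => by
    simpa using hasDerivAt_glue hu hu0 (by simpa using hf0) t
  have he₁ : deriv (glue reflection x) = glue (-reflection) u := funext fun t => (hd₁ t).deriv
  have he₂ : deriv (glue (-reflection) u) = glue reflection f := funext fun t => (hd₂ t).deriv
  constructor
  · rw [show (2 : WithTop ℕ∞) = 1 + 1 from rfl, contDiff_succ_iff_deriv, he₁,
      contDiff_one_iff_deriv, he₂]
    exact ⟨fun t => (hd₁ t).differentiableAt, by simp,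
      fun t => (hd₂ t).differentiableAt, continuous_glue hf hf0⟩
  · intro i t ht
    have hi : deriv (fun s => glue reflection x s i) = fun s => glue (-reflection) u s i :=
      funext fun s => (hasDerivAt_pi.1 (hd₁ s) i).deriv
    rw [hi, (hasDerivAt_pi.1 (hd₂ t) i).deriv]
    change _ = force (glue reflection x t) i
    rcases le_or_gt 0 t with h | h
    · simp only [glue, if_pos h, hfx t ⟨h, ht.2⟩]
    · simp only [glue, if_neg (not_le.2 h), force_reflection]
      rw [hfx (-t) ⟨by linarith, by linarith [ht.1]⟩]

/-- backward extension across `t = 0` by the reflection symmetry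
`q̄₁(t) = (q₁ₓ(−t), −q₁ᵧ(−t))`, `q̄₂(t) = (q₂ₓ(−t), −q₂ᵧ(−t))`,
`q̄₃(t) = (q₄ₓ(−t), −q₄ᵧ(−t))`, `q̄₄(t) = (q₃ₓ(−t), −q₃ᵧ(−t))` yields a classical
(`C²`, collision-free) solution of the Newtonian equations on `(−1,1)`. -/
theorem statement5 (θ : ℝ) (E : Set (Fin 4 → ℝ × ℝ))
    (hE : E = QE1set θ ∨ E = QE2set θ)
    (p : H1Path4) (hp : isMin E p)
    (hreg : ContDiffOn ℝ 1 p.q (Icc (0:ℝ) 1))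
    (hnewton : newton p.q (Ioo (0:ℝ) 1))
    (hnc : ∀ i j : Fin 4, i ≠ j → p.q 0 i ≠ p.q 0 j) :
    let σ : Fin 4 → Fin 4 := ![0, 1, 3, 2]
    let Qbar : ℝ → Fin 4 → ℝ × ℝ := fun t i =>
      if 0 ≤ t then p.q t i
      else ((p.q (-t) (σ i)).1, -(p.q (-t) (σ i)).2)
    ContDiffOn ℝ 2 Qbar (Ioo (-1:ℝ) 1) ∧
    (∀ t ∈ Ioo (-1:ℝ) 1, ∀ i j : Fin 4, i ≠ j → Qbar t i ≠ Qbar t j) ∧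
    newton Qbar (Ioo (-1:ℝ) 1) := by
  intro σ Qbar
  obtain ⟨q, v, hq, hv, hqp, haction⟩ := exists_C1_representative p hreg
  have hmin : isMin E (H1Path4.ofC1 q v hq hv) := by
    refine ⟨⟨fun t ht => ?_, ?_, ?_⟩, fun p' hp' => haction ▸ hp.2 p' hp'⟩
    · change ∑ i, q t i = 0
      rw [hqp ht]
      exact hp.1.1 t ht
    · change q 0 ∈ QSset
      rw [hqp (by simp)]
      exact hp.1.2.1
    · change q 1 ∈ E
      rw [hqp (by simp)]
      exact hp.1.2.2
  have hfin : action p ≠ ⊤ := by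
    obtain ⟨p₀, hp₀, hne⟩ := exists_admissible_action_ne_top hE
    exact ne_top_of_le_ne_top hne (hp.2 p₀ hp₀)
  obtain ⟨K, hK⟩ := hreg.exists_lipschitzOnWith one_ne_zero (convex_Icc 0 1) isCompact_Icc
  have hcf : ∀ t ∈ Icc (0 : ℝ) 1, q t ∈ collisionFree := by
    intro t ht
    rw [hqp ht]
    refine collisionFree_of_action_ne_top (K := K) (fun s hs r hr => ?_) hfin ht
    simpa [dist_eq_norm] using hK.dist_le_mul r hr s hs
  obtain ⟨x, u, f, hx, hu, hf, hxq, hfq, husum, horth⟩ := exists_newton_solution hq hv hmin hcf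
  have hx0 : reflection (x 0) = x 0 := by
    rw [hxq (by simp)]
    exact reflection_of_mem_QSset hmin.1.2.1
  obtain ⟨hsmooth, hnewt⟩ := glue_solution hx hu hf
    (fun t ht => by rw [hfq t (Ico_subset_Icc_self ht), hxq (Ico_subset_Icc_self ht)]) hx0
    (neg_reflection_of_orthogonal husum horth)
  have hQ : EqOn Qbar (glue reflection x) (Ioo (-1) 1) := by
    intro t ht
    funext i
    rcases le_or_gt 0 t with h | h
    · have htI : t ∈ Icc (0 : ℝ) 1 := ⟨h, ht.2.le⟩
      simp only [Qbar, glue, if_pos h, hxq htI, hqp htI]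
    · have htI : -t ∈ Icc (0 : ℝ) 1 := ⟨by linarith, by linarith [ht.1]⟩
      simp only [Qbar, glue, if_neg (not_le.2 h), hxq htI, hqp htI, reflection_apply, σ]
  refine ⟨hsmooth.contDiffOn.congr hQ, fun t ht => ?_, fun i t ht => ?_⟩
  · change Qbar t ∈ collisionFree
    rw [hQ ht]
    rcases le_or_gt 0 t with h | h
    · have htI : t ∈ Icc (0 : ℝ) 1 := ⟨h, ht.2.le⟩
      simp only [glue, if_pos h, hxq htI, hcf t htI]
    · have htI : -t ∈ Icc (0 : ℝ) 1 := ⟨by linarith, by linarith [ht.1]⟩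
      simp only [glue, if_neg (not_le.2 h), hxq htI]
      exact reflection_mem_collisionFree (hcf _ htI)
  · have hev : (fun s => Qbar s i) =ᶠ[nhds t] fun s => glue reflection x s i := by
      filter_upwards [isOpen_Ioo.mem_nhds ht] with s hs
      rw [hQ hs]
    rw [hev.deriv.deriv_eq, hnewt i t ht, hQ ht]

end
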